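/- RPSO(μ,φ,𝒪) = 1 if and only if for every observable o : Obs the conditional probability of φ in its class is one half: μ(φ ∩ 𝒪⁻¹(o)) / μ(𝒪⁻¹(o)) = 1/2 for all o. (Proposition 3, item 3 of the paper.) -/

import Mathlib

open scoped ENNReal Classical

/-- The probability of a set of runs under a PMF. -/
noncomputable def mOf {R : Type*} (μ : PMF R) (S : Set R) : ℝ≥0∞ :=
  ∑' ρ : S, μ ρ

/-- Liberal probabilistic opacity. -/
noncomputable def LPO {R Obs : Type*} (μ : PMF R) (φ : Set R) (O : R → Obs) : ℝ≥0∞ :=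
  ∑' o : Obs, if O ⁻¹' {o} ⊆ φ then mOf μ (O ⁻¹' {o}) else 0

/-- Liberal probabilistic symmetrical opacity. -/
noncomputable def LPSO {R Obs : Type*} (μ : PMF R) (φ : Set R) (O : R → Obs) : ℝ≥0∞ :=
  LPO μ φ O + LPO μ φᶜ O

/-- Restrictive probabilistic opacity. -/
noncomputable def RPO {R Obs : Type*} (μ : PMF R) (φ : Set R) (O : R → Obs) : ℝ≥0∞ :=
  (∑' o : Obs, (mOf μ (O ⁻¹' {o})) ^ 2 / mOf μ (φᶜ ∩ O ⁻¹' {o}))⁻¹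

/-- Vulnerability of φ within the observation class of o. -/
noncomputable def Vul {R Obs : Type*} (μ : PMF R) (φ : Set R) (O : R → Obs) (o : Obs) : ℝ≥0∞ :=
  max (mOf μ (φ ∩ O ⁻¹' {o})) (mOf μ (φᶜ ∩ O ⁻¹' {o})) / mOf μ (O ⁻¹' {o})

/-- Restrictive probabilistic symmetric opacity. -/
noncomputable def RPSO {R Obs : Type*} (μ : PMF R) (φ : Set R) (O : R → Obs) : ℝ≥0∞ :=
  (∑' o : Obs, mOf μ (O ⁻¹' {o}) *
    (if Vul μ φ O o = 1 then ⊤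
     else ENNReal.ofReal (- Real.logb 2 ((1 - Vul μ φ O o).toReal))))⁻¹

/-- φ is opaque for the observation O. -/
def IsOpaque {R Obs : Type*} (φ : Set R) (O : R → Obs) : Prop :=
  ∀ o : Obs, ¬ O ⁻¹' {o} ⊆ φ

/-- φ is symmetrically opaque for the observation O. -/
def IsSymOpaque {R Obs : Type*} (φ : Set R) (O : R → Obs) : Prop :=
  ∀ o : Obs, ¬ O ⁻¹' {o} ⊆ φ ∧ ¬ O ⁻¹' {o} ⊆ φᶜ

theorem mOf_ne_zero {R : Type*} {μ : PMF R} {S : Set R} {ρ : R} (hρ : ρ ∈ S) (h : μ ρ ≠ 0) :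
    mOf μ S ≠ 0 := fun h0 =>
  h (ENNReal.tsum_eq_zero.1 h0 ⟨ρ, hρ⟩)

theorem mOf_le_one {R : Type*} (μ : PMF R) (S : Set R) : mOf μ S ≤ 1 :=
  (ENNReal.tsum_comp_le_tsum_of_injective Subtype.val_injective _).trans_eq μ.tsum_coe

theorem mOf_ne_top {R : Type*} (μ : PMF R) (S : Set R) : mOf μ S ≠ ∞ :=
  ne_top_of_le_ne_top ENNReal.one_ne_top (mOf_le_one μ S)

theorem mOf_inter_add_mOf_compl_inter {R : Type*} (μ : PMF R) (φ S : Set R) :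
    mOf μ (φ ∩ S) + mOf μ (φᶜ ∩ S) = mOf μ S := by
  have hdisj : Disjoint (φ ∩ S) (φᶜ ∩ S) :=
    disjoint_compl_right.mono Set.inter_subset_left Set.inter_subset_left
  have hunion : (φ ∩ S) ∪ (φᶜ ∩ S) = S := by
    rw [← Set.union_inter_distrib_right, Set.union_compl_self, Set.univ_inter]
  rw [mOf, mOf, ← ENNReal.summable.tsum_union_disjoint (f := fun ρ => μ ρ) hdisj
    ENNReal.summable, hunion, mOf]

theorem tsum_mOf_preimage {R Obs : Type*} (μ : PMF R) (O : R → Obs) :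
    ∑' o : Obs, mOf μ (O ⁻¹' {o}) = 1 :=
  (ENNReal.tsum_fiberwise μ O).trans μ.tsum_coe

/-- A weighted mean of numbers that are at least one equals one only if all of them do. -/
theorem ENNReal.tsum_mul_eq_one_iff {ι : Type*} {w f : ι → ℝ≥0∞} (hw : ∑' i, w i = 1)
    (hw0 : ∀ i, w i ≠ 0) (hf : ∀ i, 1 ≤ f i) :
    ∑' i, w i * f i = 1 ↔ ∀ i, f i = 1 := by
  refine ⟨fun h i => ?_, fun h => by simpa [h] using hw⟩
  by_contra hi
  have hlt : w i * 1 < w i * f i :=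
    (ENNReal.mul_lt_mul_iff_right (hw0 i)
      (ENNReal.ne_top_of_tsum_ne_top (hw ▸ ENNReal.one_ne_top) i)).2
      (lt_of_le_of_ne (hf i) (Ne.symm hi))
  have := ENNReal.tsum_lt_tsum (f := w) (g := fun i => w i * f i) (i := i)
    (hw ▸ ENNReal.one_ne_top) (fun j => le_mul_of_one_le_right' (hf j)) (by simpa using hlt)
  rw [hw, h] at this
  exact this.false

theorem one_le_neg_logb_one_sub_and_eq_one_iff {x : ℝ} (hx : 1 / 2 ≤ x) (hx1 : x < 1) :
    1 ≤ -Real.logb 2 (1 - x) ∧ (-Real.logb 2 (1 - x) = 1 ↔ x = 1 / 2) := by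
  have hpos : 0 < 1 - x := sub_pos.2 hx1
  refine ⟨?_, ?_⟩
  · rw [le_neg, Real.logb_le_iff_le_rpow one_lt_two hpos, Real.rpow_neg_one]
    linarith
  · rw [neg_eq_iff_eq_neg, Real.logb_eq_iff_rpow_eq two_pos (by norm_num) hpos,
      Real.rpow_neg_one]
    constructor <;> intro h <;> linarith

theorem one_le_ite_neg_logb_and_eq_one_iff {V : ℝ≥0∞} (hV : 1 / 2 ≤ V) (hV1 : V ≤ 1) :
    1 ≤ (if V = 1 then ⊤ else ENNReal.ofReal (-Real.logb 2 ((1 - V).toReal))) ∧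
    ((if V = 1 then ⊤ else ENNReal.ofReal (-Real.logb 2 ((1 - V).toReal))) = 1 ↔
      V = 1 / 2) := by
  by_cases h : V = 1
  · have hne : (1 : ℝ≥0∞) ≠ 2⁻¹ := ENNReal.one_half_lt_one.ne'
    simp [h, hne]
  have hV_top : V ≠ ∞ := ne_top_of_le_ne_top ENNReal.one_ne_top hV1
  lift V to NNReal using hV_top
  have hx : (1 / 2 : ℝ) ≤ V := by
    simpa using ENNReal.toReal_mono ENNReal.coe_ne_top hV
  have hx1 : (V : ℝ) < 1 := by
    exact_mod_cast lt_of_le_of_ne hV1 h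
  obtain ⟨hle, heq⟩ := one_le_neg_logb_one_sub_and_eq_one_iff hx hx1
  have hhalf : (V : ℝ≥0∞) = 1 / 2 ↔ (V : ℝ) = 1 / 2 := by
    rw [← ENNReal.toReal_eq_toReal_iff' ENNReal.coe_ne_top (by simp)]
    simp
  rw [if_neg h, ENNReal.toReal_sub_of_le hV1 ENNReal.one_ne_top, ENNReal.toReal_one,
    ENNReal.coe_toReal, ENNReal.one_le_ofReal, ENNReal.ofReal_eq_one, hhalf]
  exact ⟨hle, heq⟩

theorem ENNReal.half_le_max_and_max_eq_half_iff {p q : ℝ≥0∞} (h : p + q = 1) :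
    1 / 2 ≤ max p q ∧ max p q ≤ 1 ∧ (max p q = 1 / 2 ↔ p = 1 / 2) := by
  have hp1 : p ≤ 1 := h ▸ le_self_add
  have hq1 : q ≤ 1 := h ▸ le_add_self
  lift p to NNReal using ne_top_of_le_ne_top ENNReal.one_ne_top hp1
  lift q to NNReal using ne_top_of_le_ne_top ENNReal.one_ne_top hq1
  have hhalf : (1 / 2 : ℝ≥0∞) = ((1 / 2 : NNReal) : ℝ≥0∞) := by simp
  rw [hhalf]
  norm_cast at h hp1 hq1 ⊢
  rw [← NNReal.coe_inj] at h
  simp only [← NNReal.coe_le_coe, ← NNReal.coe_inj] at hp1 hq1 ⊢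
  push_cast at h hp1 hq1 ⊢
  grind

/-- Proposition 3, item 3: RPSO equals one iff every observation class is perfectly
balanced between φ and its complement. -/
theorem rpso_eq_one_iff_balanced {R Obs : Type*} [Countable R]
    (μ : PMF R) (φ : Set R) (O : R → Obs)
    (hsupp : ∀ ρ : R, μ ρ ≠ 0) (hsurj : Function.Surjective O) :
    RPSO μ φ O = 1 ↔
      ∀ o : Obs, mOf μ (φ ∩ O ⁻¹' {o}) / mOf μ (O ⁻¹' {o}) = 1 / 2 := by
  have hm0 (o : Obs) : mOf μ (O ⁻¹' {o}) ≠ 0 := by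
    obtain ⟨ρ, hρ⟩ := hsurj o
    exact mOf_ne_zero (ρ := ρ) hρ (hsupp ρ)
  have hV (o : Obs) : 1 / 2 ≤ Vul μ φ O o ∧ Vul μ φ O o ≤ 1 ∧ (Vul μ φ O o = 1 / 2 ↔
      mOf μ (φ ∩ O ⁻¹' {o}) / mOf μ (O ⁻¹' {o}) = 1 / 2) := by
    have hmax : Vul μ φ O o = max (mOf μ (φ ∩ O ⁻¹' {o}) / mOf μ (O ⁻¹' {o}))
        (mOf μ (φᶜ ∩ O ⁻¹' {o}) / mOf μ (O ⁻¹' {o})) :=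
      Monotone.map_max (f := fun x : ℝ≥0∞ => x / mOf μ (O ⁻¹' {o}))
        fun _ _ h => ENNReal.div_le_div_right h _
    rw [hmax]
    apply ENNReal.half_le_max_and_max_eq_half_iff
    rw [ENNReal.div_add_div_same, mOf_inter_add_mOf_compl_inter,
      ENNReal.div_self (hm0 o) (mOf_ne_top μ _)]
  have hf (o : Obs) := one_le_ite_neg_logb_and_eq_one_iff (hV o).1 (hV o).2.1
  rw [RPSO, ENNReal.inv_eq_one, ENNReal.tsum_mul_eq_one_iff (tsum_mOf_preimage μ O) hm0
    fun o => (hf o).1]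
  exact forall_congr' fun o => (hf o).2.trans (hV o).2.2
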